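/- arXiv:0804.2593 — 2 statements merged into one kernel-verified Lean document; each statement's English description precedes it below -/
import Mathlib

section
/- (Dicks–Ivanov conjecture, abelian case) Let A, B be finite subsets of an abelian group G with 2 ≤ |B| ≤ |A|. Then either |N_1(A,B)| + |N_2(A,B)| ≥ 2(|A| + |B| − 2), or N_2(A,B) contains a coset of cardinality at least 3. -/
open Finset Pointwise

variable {G : Type*} [CommGroup G] [DecidableEq G]

/-- Number of representations of `x` as a product `a * b` with `a ∈ A`, `b ∈ B`. -/
def rep (A B : Finset G) (x : G) : ℕ :=
  ((A ×ˢ B).filter (fun p => p.1 * p.2 = x)).card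

/-- Elements of `A * B` having at least `t` representations. -/
def N (t : ℕ) (A B : Finset G) : Finset G :=
  (A * B).filter (fun x => t ≤ rep A B x)

/-- `α(A,B)`: cardinality of the largest coset of a subgroup contained in `A * B`. -/
noncomputable def alphaC (A B : Finset G) : ℕ :=
  sSup {n | ∃ (H : Subgroup G) (g : G) (C : Finset G),
    (C : Set G) = g • (H : Set G) ∧ C ⊆ A * B ∧ C.card = n}

theorem mem_N_iff {t : ℕ} (ht : 1 ≤ t) (A B : Finset G) (x : G) :
    x ∈ N t A B ↔ t ≤ rep A B x := by
  refine ⟨fun h => (mem_filter.1 h).2, fun h => mem_filter.2 ⟨?_, h⟩⟩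
  obtain ⟨p, hp⟩ := Finset.card_pos.1 (ht.trans h)
  obtain ⟨hmem, rfl⟩ := mem_filter.1 hp
  exact mul_mem_mul (mem_product.1 hmem).1 (mem_product.1 hmem).2

theorem rep_eq_card_filter (A B : Finset G) (x : G) :
    rep A B x = #{a ∈ A | a⁻¹ * x ∈ B} := by
  refine card_bij' (fun p _ => p.1) (fun a _ => (a, a⁻¹ * x)) ?_ ?_ ?_ ?_
  · rintro ⟨a, b⟩ h
    simp only [mem_filter, mem_product] at h ⊢
    obtain ⟨⟨ha, hb⟩, rfl⟩ := h
    simpa using ⟨ha, hb⟩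
  · intro a h
    simpa using h
  · rintro ⟨a, b⟩ h
    simp only [mem_filter] at h
    simp [← h.2]
  · intro a _
    rfl

theorem rep_comm (A B : Finset G) (x : G) : rep A B x = rep B A x := by
  refine card_bij' (fun p _ => p.swap) (fun p _ => p.swap) ?_ ?_ ?_ ?_ <;>
    simp +contextual [mul_comm]

theorem N_comm (t : ℕ) (A B : Finset G) : N t A B = N t B A := by
  simp only [N, mul_comm A B, rep_comm A B]

theorem N_subset_N {A B A' B' : Finset G} (h : ∀ x, rep A' B' x ≤ rep A B x) {t : ℕ}
    (ht : 1 ≤ t) : N t A' B' ⊆ N t A B := fun x hx =>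
  (mem_N_iff ht _ _ x).2 (((mem_N_iff ht _ _ x).1 hx).trans (h x))

/-- The truncated representation sum `∑ min 2 (rep x)` counts `N 1` and `N 2`. -/
theorem card_N_one_add_card_N_two {A B S : Finset G} (hS : A * B ⊆ S) :
    #(N 1 A B) + #(N 2 A B) = ∑ x ∈ S, min 2 (rep A B x) := by
  have key : ∀ t, 1 ≤ t → N t A B = {x ∈ S | t ≤ rep A B x} := by
    intro t ht
    ext x
    rw [mem_filter, mem_N_iff ht]
    exact ⟨fun h => ⟨hS (mem_filter.1 ((mem_N_iff ht A B x).2 h)).1, h⟩, And.right⟩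
  rw [key 1 le_rfl, key 2 one_le_two, card_filter, card_filter, ← sum_add_distrib]
  refine sum_congr rfl fun x _ => ?_
  split_ifs <;> omega

theorem card_N_one_add_card_N_two_of_card_eq_two {A B : Finset G} (hA : #A = 2) :
    #(N 1 A B) + #(N 2 A B) = 2 * #B := by
  have hle : ∀ x, rep A B x ≤ 2 := fun x => by
    rw [rep_eq_card_filter, ← hA]
    exact card_filter_le _ _
  rw [card_N_one_add_card_N_two subset_rfl, ← hA, ← card_product,
    card_eq_sum_card_fiberwise (f := fun p : G × G => p.1 * p.2) (t := A * B)
      fun p hp => mul_mem_mul (mem_product.1 hp).1 (mem_product.1 hp).2]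
  exact sum_congr rfl fun x _ => min_eq_right ((hle x).trans hA.ge)

theorem rep_erase_add {A B : Finset G} {a : G} (ha : a ∈ A) (x : G) :
    rep (A.erase a) B x + (if a⁻¹ * x ∈ B then 1 else 0) = rep A B x := by
  rw [rep_eq_card_filter, rep_eq_card_filter, card_filter, card_filter,
    sum_erase_add _ _ ha]

/-- Removing a factor involved in two products with few representations lowers
`#(N 1 A B) + #(N 2 A B)` by at least two. -/
theorem card_N_erase_add_two_le {A B : Finset G} {a b₁ b₂ : G} (ha : a ∈ A) (hb₁ : b₁ ∈ B)
    (hb₂ : b₂ ∈ B) (hne : b₁ ≠ b₂) (h₁ : rep A B (a * b₁) ≤ 2) (h₂ : rep A B (a * b₂) ≤ 2) :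
    #(N 1 (A.erase a) B) + #(N 2 (A.erase a) B) + 2 ≤ #(N 1 A B) + #(N 2 A B) := by
  rw [card_N_one_add_card_N_two (mul_subset_mul_right (erase_subset a A)),
    card_N_one_add_card_N_two subset_rfl]
  have hsub : ({a * b₁, a * b₂} : Finset G) ⊆ A * B := by
    simp [insert_subset_iff, mul_mem_mul ha hb₁, mul_mem_mul ha hb₂]
  have hcard : #{x ∈ A * B | x ∈ ({a * b₁, a * b₂} : Finset G)} = 2 := by
    rw [filter_mem_eq_inter, inter_eq_right.2 hsub, card_pair (by simpa using hne)]
  rw [card_filter] at hcard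
  refine (congrArg _ hcard.symm).le.trans ?_
  rw [← sum_add_distrib]
  refine sum_le_sum fun x _ => ?_
  have hx := rep_erase_add (B := B) ha x
  split_ifs with hmem
  · have : a⁻¹ * x ∈ B ∧ rep A B x ≤ 2 := by
      simp only [mem_insert, mem_singleton] at hmem
      rcases hmem with rfl | rfl
      · simpa using ⟨hb₁, h₁⟩
      · simpa using ⟨hb₂, h₂⟩
    rw [if_pos this.1] at hx
    omega
  · omega

theorem rep_dysonTransform_le (A B : Finset G) (e x : G) :
    rep (A ∪ e • B) (B ∩ e⁻¹ • A) x ≤ rep A B x := by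
  refine card_le_card_of_injOn
    (fun p => if p.1 ∈ A then p else (e * p.2, e⁻¹ * p.1)) ?_ ?_
  · rintro ⟨p, q⟩ h
    simp only [coe_filter, Set.mem_ofPred_eq, mem_product, mem_union, mem_inter,
      mem_inv_smul_finset_iff, smul_eq_mul] at h ⊢
    obtain ⟨⟨hp, hq, hq'⟩, rfl⟩ := h
    split_ifs with hpA
    · exact ⟨⟨hpA, hq⟩, rfl⟩
    · refine ⟨⟨hq', ?_⟩, ?_⟩
      · exact inv_smul_mem_iff.2 (hp.resolve_left hpA)
      · rw [mul_mul_mul_comm, mul_inv_cancel, one_mul, mul_comm]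
  · rintro ⟨p, q⟩ h ⟨p', q'⟩ h' heq
    simp only [coe_filter, Set.mem_ofPred_eq, mem_product, mem_union, mem_inter,
      mem_inv_smul_finset_iff, smul_eq_mul] at h h' heq
    split_ifs at heq with h₁ h₂ h₂
    · exact heq
    · obtain ⟨rfl, rfl⟩ := Prod.mk.inj heq
      exact absurd (by simpa using h.1.2.2) h₂
    · obtain ⟨rfl, rfl⟩ := Prod.mk.inj heq
      exact absurd (by simpa using h'.1.2.2) h₁
    · obtain ⟨hq, hp⟩ := Prod.mk.inj heq
      rw [mul_left_cancel hq, mul_left_cancel hp]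

/-- If `A` contains every translate of `B` that it meets, then `N 2 A B` contains a coset of a
subgroup of order at least `#B`. -/
theorem exists_coset_subset_N_two {A B : Finset G} (hA : A.Nonempty) (hB : 2 ≤ #B)
    (h : ∀ a ∈ A, ∀ b ∈ B, ∀ b' ∈ B, a * b⁻¹ * b' ∈ A) :
    ∃ (H : Subgroup G) (g : G) (C : Finset G),
      (C : Set G) = g • (H : Set G) ∧ C ⊆ N 2 A B ∧ #B ≤ #C := by
  obtain ⟨a, ha⟩ := hA
  obtain ⟨b, hb⟩ : B.Nonempty := card_pos.1 (by omega)
  let H := MulAction.stabilizer G A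
  have hHA : ∀ k ∈ H, k * a ∈ A := fun k hk => by
    have hk : k • A = A := hk
    rw [← hk]
    exact smul_mem_smul_finset ha
  have hBH : ∀ b' ∈ B, b⁻¹ * b' ∈ H := fun b' hb' => by
    refine eq_of_subset_of_card_le (fun x hx => ?_) (card_smul_finset _ _).ge
    obtain ⟨y, hy, rfl⟩ := mem_smul_finset.1 hx
    have := h y hy b hb b' hb'
    rwa [smul_eq_mul, mul_comm, ← mul_assoc]
  have hfin : ((a * b) • (H : Set G)).Finite := by
    refine (A.image (· * b)).finite_toSet.subset ?_
    rintro _ ⟨k, hk, rfl⟩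
    refine mem_coe.2 (mem_image.2 ⟨k * a, hHA k hk, ?_⟩)
    simp only [smul_eq_mul, mul_comm k, mul_right_comm]
  refine ⟨H, a * b, hfin.toFinset, hfin.coe_toFinset, fun x hx => ?_, ?_⟩
  · obtain ⟨k, hk, rfl⟩ := hfin.mem_toFinset.1 hx
    rw [mem_N_iff one_le_two, rep_comm, rep_eq_card_filter, filter_true_of_mem]
    · exact hB
    · intro b' hb'
      have := h _ (hHA k hk) b' hb' b hb
      convert this using 1
      simp only [smul_eq_mul]
      rw [mul_comm, mul_right_comm (k * a), mul_comm k a, mul_right_comm a k]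
  · refine card_le_card_of_injOn (fun b' => a * b') (fun b' hb' => ?_)
      (mul_right_injective a).injOn
    refine mem_coe.2 (hfin.mem_toFinset.2 ⟨b⁻¹ * b', hBH b' hb', ?_⟩)
    simp [mul_assoc]

/-- A translate of `B` meeting `A` in one point gives the bound, provided each factor is involved
in at most one product with few representations. -/
theorem le_card_N_of_card_inter_eq_one {A B : Finset G} {e : G} (he : #(A ∩ e • B) = 1)
    (hA : ∀ a ∈ A, #{b ∈ B | rep A B (a * b) ≤ 2} ≤ 1)
    (hB : ∀ b ∈ B, #{a ∈ A | rep A B (a * b) ≤ 2} ≤ 1) :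
    2 * (#A + #B) ≤ #(N 1 A B) + #(N 2 A B) + 4 := by
  obtain ⟨x, hx⟩ := card_eq_one.1 he
  have hxmem : x ∈ A ∩ e • B := hx ▸ mem_singleton_self x
  obtain ⟨hxA, hxB⟩ := mem_inter.1 hxmem
  obtain ⟨b, hb, rfl⟩ := mem_smul_finset.1 hxB
  rw [smul_eq_mul] at *
  let S := A.image (· * b) ∪ B.image (e * b * ·)
  have hinter : A.image (· * b) ∩ B.image (e * b * ·) ⊆ {e * b * b} := by
    intro y hy
    obtain ⟨h₁, h₂⟩ := mem_inter.1 hy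
    obtain ⟨a, ha, rfl⟩ := mem_image.1 h₁
    obtain ⟨b', hb', heq⟩ := mem_image.1 h₂
    have hab : a = e * b' := by
      rw [mul_right_comm] at heq
      exact (mul_right_cancel heq).symm
    have : a ∈ A ∩ e • B := mem_inter.2 ⟨ha, hab ▸ smul_mem_smul_finset hb'⟩
    rw [hx, mem_singleton] at this
    simp [this]
  have hScard : #A + #B ≤ #S + 1 := by
    have h₁ : #S + _ = _ :=
      card_union_add_card_inter (A.image (· * b)) (B.image (e * b * ·))
    rw [card_image_of_injective _ (mul_left_injective b),
      card_image_of_injective _ (mul_right_injective (e * b))] at h₁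
    have h₂ := card_le_card hinter
    rw [card_singleton] at h₂
    omega
  have hS1 : S ⊆ A * B := by
    refine union_subset (image_subset_iff.2 fun a ha => mul_mem_mul ha hb)
      (image_subset_iff.2 fun b' hb' => mul_mem_mul hxA hb')
  have hN1 : S ⊆ N 1 A B := fun y hy => by
    obtain ⟨a, ha, b', hb', rfl⟩ := mem_mul.1 (hS1 hy)
    exact (mem_N_iff le_rfl _ _ _).2
      (card_pos.2 ⟨(a, b'), mem_filter.2 ⟨mem_product.2 ⟨ha, hb'⟩, rfl⟩⟩)
  have hN2 : S ⊆ N 2 A B ∪ ({a ∈ A | rep A B (a * b) ≤ 2}.image (· * b) ∪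
      {b' ∈ B | rep A B (e * b * b') ≤ 2}.image (e * b * ·)) := fun y hy => by
    rcases le_total 2 (rep A B y) with hr | hr
    · exact mem_union_left _ ((mem_N_iff one_le_two _ _ _).2 hr)
    · refine mem_union_right _ ?_
      rcases mem_union.1 hy with hy | hy
      · obtain ⟨a, ha, rfl⟩ := mem_image.1 hy
        exact mem_union_left _ (mem_image_of_mem _ (mem_filter.2 ⟨ha, hr⟩))
      · obtain ⟨b', hb', rfl⟩ := mem_image.1 hy
        exact mem_union_right _ (mem_image_of_mem _ (mem_filter.2 ⟨hb', hr⟩))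
  have h₁ := card_le_card hN1
  have h₂ := (card_le_card hN2).trans ((card_union_le _ _).trans
    (Nat.add_le_add_left ((card_union_le _ _).trans
      (Nat.add_le_add (card_image_le.trans (hB b hb)) (card_image_le.trans (hA _ hxA)))) _))
  omega

theorem le_card_N_or_exists_coset (n : ℕ) : ∀ A B : Finset G, #A + 2 * #B = n → 2 ≤ #A → 2 ≤ #B →
    2 * (#A + #B) ≤ #(N 1 A B) + #(N 2 A B) + 4 ∨
    ∃ (H : Subgroup G) (g : G) (C : Finset G),
      (C : Set G) = g • (H : Set G) ∧ C ⊆ N 2 A B ∧ 3 ≤ #C := by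
  induction n using Nat.strong_induction_on with | _ n ih
  intro A B hn hA2 hB2
  obtain hA | hA3 := hA2.eq_or_lt
  · left
    rw [card_N_one_add_card_N_two_of_card_eq_two hA.symm]
    omega
  obtain hB | hB3 := hB2.eq_or_lt
  · left
    rw [N_comm 1, N_comm 2, card_N_one_add_card_N_two_of_card_eq_two hB.symm]
    omega
  by_cases hA : ∀ a ∈ A, #{b ∈ B | rep A B (a * b) ≤ 2} ≤ 1
  swap
  · push Not at hA
    obtain ⟨a, ha, hcard⟩ := hA
    obtain ⟨b₁, hb₁, b₂, hb₂, hne⟩ := one_lt_card.1 hcard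
    rw [mem_filter] at hb₁ hb₂
    have hle := card_N_erase_add_two_le ha hb₁.1 hb₂.1 hne hb₁.2 hb₂.2
    have hc := card_erase_add_one ha
    refine (ih _ ?_ (A.erase a) B rfl (by omega) hB2).imp (fun h => by omega) ?_
    · omega
    · rintro ⟨H, g, C, hC, hCN, h3⟩
      exact ⟨H, g, C, hC, hCN.trans (N_subset_N
        (fun x => (Nat.le_add_right _ _).trans (rep_erase_add ha x).le) one_le_two), h3⟩
  by_cases hB : ∀ b ∈ B, #{a ∈ A | rep A B (a * b) ≤ 2} ≤ 1
  swap
  · push Not at hB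
    obtain ⟨b, hb, hcard⟩ := hB
    obtain ⟨a₁, ha₁, a₂, ha₂, hne⟩ := one_lt_card.1 hcard
    rw [mem_filter, rep_comm, mul_comm] at ha₁ ha₂
    have hle := card_N_erase_add_two_le hb ha₁.1 ha₂.1 hne ha₁.2 ha₂.2
    have hc := card_erase_add_one hb
    rw [N_comm 1 B, N_comm 2 B, N_comm 1 _ A, N_comm 2 _ A] at hle
    refine (ih _ ?_ A (B.erase b) rfl hA2 (by omega)).imp (fun h => by omega) ?_
    · omega
    · rintro ⟨H, g, C, hC, hCN, h3⟩
      refine ⟨H, g, C, hC, hCN.trans (N_subset_N (fun x => ?_) one_le_two), h3⟩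
      rw [rep_comm, rep_comm A]
      exact (Nat.le_add_right _ _).trans (rep_erase_add hb x).le
  by_cases h1 : ∃ e : G, #(A ∩ e • B) = 1
  · obtain ⟨e, he⟩ := h1
    exact .inl (le_card_N_of_card_inter_eq_one he hA hB)
  by_cases h2 : ∃ e : G, 2 ≤ #(A ∩ e • B) ∧ #(A ∩ e • B) < #B
  · obtain ⟨e, he2, helt⟩ := h2
    have hB' : #(B ∩ e⁻¹ • A) = #(A ∩ e • B) := by
      rw [← card_smul_finset e, smul_finset_inter, smul_inv_smul, inter_comm]
    have hA' := card_union_add_card_inter A (e • B)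
    rw [card_smul_finset] at hA'
    have hrep := rep_dysonTransform_le A B e
    have hN1 := card_le_card (N_subset_N hrep le_rfl)
    have hN2 := card_le_card (N_subset_N hrep one_le_two)
    refine (ih _ ?_ (A ∪ e • B) (B ∩ e⁻¹ • A) rfl ?_ ?_).imp (fun h => by omega) ?_
    · omega
    · omega
    · omega
    · rintro ⟨H, g, C, hC, hCN, h3⟩
      exact ⟨H, g, C, hC, hCN.trans (N_subset_N hrep one_le_two), h3⟩
  right
  push Not at h1 h2
  obtain ⟨H, g, C, hC, hCN, hle⟩ := exists_coset_subset_N_two (A := A) (B := B)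
    (card_pos.1 (by omega)) hB2 (fun a ha b hb b' hb' => by
      set e := a * b⁻¹
      have hmem : a ∈ A ∩ e • B :=
        mem_inter.2 ⟨ha, mem_smul_finset.2 ⟨b, hb, by simp [e]⟩⟩
      have hpos := card_pos.2 ⟨a, hmem⟩
      have hcard : #(e • B) ≤ #(A ∩ e • B) := by
        rw [card_smul_finset]
        have := h1 e
        exact h2 e (by omega)
      have hsub := eq_of_subset_of_card_le inter_subset_right hcard
      have : e * b' ∈ A ∩ e • B := by
        rw [hsub]
        exact smul_mem_smul_finset hb'
      exact (mem_inter.1 this).1)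
  exact ⟨H, g, C, hC, hCN, by omega⟩

theorem stmt12 (A B : Finset G) (hB : 2 ≤ B.card) (hBA : B.card ≤ A.card) :
    2 * ((A.card : ℤ) + B.card - 2) ≤ ((N 1 A B).card : ℤ) + ((N 2 A B).card : ℤ) ∨
    ∃ (H : Subgroup G) (g : G) (C : Finset G),
      (C : Set G) = g • (H : Set G) ∧ C ⊆ N 2 A B ∧ 3 ≤ C.card :=
  (le_card_N_or_exists_coset _ A B rfl (hB.trans hBA) hB).imp_left fun h => by omega
end

section
/- (Consequence of Kneser's theorem) Let A, B be finite nonempty subsets of an abelian group G with |AB| ≤ |A| + |B| − 2, and let H be the period (stabilizer) of AB, i.e., H = {g ∈ G : g·AB = AB}. Then |H| ≥ 2 and |AB| = |AH| + |BH| − |H|. -/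
open Finset Pointwise

variable {G : Type*} [CommGroup G] [DecidableEq G]

/-- A finite union of cosets of a finite subgroup has cardinality divisible by that of
the subgroup. -/
lemma card_dvd_card_of_mul_mem (H : Subgroup G) (F X : Finset G) (hF : ∀ x, x ∈ F ↔ x ∈ H)
    (hX : ∀ h ∈ H, ∀ x ∈ X, h * x ∈ X) : #F ∣ #X := by
  classical
  rw [card_eq_sum_card_image (fun x : G => (x : G ⧸ H)) X]
  refine dvd_sum fun b hb => ?_
  obtain ⟨x, hx, rfl⟩ := mem_image.1 hb
  have : X.filter (fun a : G => (a : G ⧸ H) = x) = F.image (fun h => h * x) := by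
    ext a
    simp only [mem_filter, mem_image, hF]
    constructor
    · rintro ⟨-, h⟩
      refine ⟨a * x⁻¹, ?_, by simp⟩
      rw [mul_comm]
      exact QuotientGroup.eq.1 h.symm
    · rintro ⟨h, hh, rfl⟩
      refine ⟨hX h hh x hx, (QuotientGroup.eq.2 ?_).symm⟩
      simpa [mul_comm h x] using hh
  rw [this, card_image_of_injective _ (mul_left_injective x)]

lemma card_mul_card_le_card_inter_mul_card_mul (H₁ H₂ : Subgroup G) (F₁ F₂ X Y : Finset G)
    (hF₁ : ∀ x, x ∈ F₁ ↔ x ∈ H₁) (hF₂ : ∀ x, x ∈ F₂ ↔ x ∈ H₂) (hX : X ⊆ F₁) (hY : Y ⊆ F₂) :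
    #X * #Y ≤ #(F₁ ∩ F₂) * #(X * Y) := by
  rw [← card_product, ← image_mul_product]
  refine card_le_mul_card_image _ _ fun b hb => ?_
  obtain ⟨⟨x, y⟩, hxy, rfl⟩ := mem_image.1 hb
  rw [mem_product] at hxy
  refine card_le_card_of_injOn (fun p => p.1 * x⁻¹) ?_ ?_
  · rintro ⟨x', y'⟩ h
    simp only [coe_filter, mem_product, Set.mem_ofPred_eq] at h
    obtain ⟨⟨hx', hy'⟩, h⟩ := h
    have e : x' * x⁻¹ = y * y'⁻¹ := by
      rw [mul_inv_eq_iff_eq_mul, mul_assoc, mul_comm _ x, ← mul_assoc, eq_mul_inv_iff_mul_eq, h,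
        mul_comm]
    simp only [mem_coe, mem_inter, hF₁, hF₂]
    refine ⟨H₁.mul_mem ((hF₁ _).1 (hX hx')) (H₁.inv_mem ((hF₁ _).1 (hX hxy.1))), ?_⟩
    rw [e]
    exact H₂.mul_mem ((hF₂ _).1 (hY hxy.2)) (H₂.inv_mem ((hF₂ _).1 (hY hy')))
  · rintro ⟨x₁, y₁⟩ h₁ ⟨x₂, y₂⟩ h₂ h
    simp only [coe_filter, mem_product, Set.mem_ofPred_eq] at h₁ h₂
    obtain rfl : x₁ = x₂ := mul_right_cancel h
    obtain rfl : y₁ = y₂ := mul_left_cancel (h₁.2.trans h₂.2.symm)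
    rfl

lemma card_le_card_sdiff_of_card_sdiff_lt (H₁ H₂ : Subgroup G) (F₁ F₂ C₁ C₂ : Finset G)
    (hF₁ : ∀ x, x ∈ F₁ ↔ x ∈ H₁) (hF₂ : ∀ x, x ∈ F₂ ↔ x ∈ H₂)
    (hC₁ : ∀ h ∈ H₁, ∀ x, h * x ∈ C₁ ↔ x ∈ C₁) (hC₂ : ∀ h ∈ H₂, ∀ x, h * x ∈ C₂ ↔ x ∈ C₂)
    (hne : (C₂ \ C₁).Nonempty)
    (h₁ : #(C₂ \ C₁) + #(F₁ ∩ F₂) < #F₁) (h₂ : #(C₁ \ C₂) + #(F₁ ∩ F₂) < #F₂) :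
    #F₂ ≤ #(C₂ \ C₁) := by
  obtain ⟨c, hc⟩ := hne
  rw [mem_sdiff] at hc
  have hF : ∀ x, x ∈ F₁ ∩ F₂ ↔ x ∈ H₁ ⊓ H₂ := fun x => by
    rw [mem_inter, hF₁, hF₂, Subgroup.mem_inf]
  have hC₁' : ∀ h ∈ H₁, ∀ x, c * (h * x) ∈ C₁ ↔ c * x ∈ C₁ := fun h hh x => by
    rw [mul_left_comm, hC₁ h hh]
  have hC₂' : ∀ h ∈ H₂, ∀ x, c * (h * x) ∈ C₂ ↔ c * x ∈ C₂ := fun h hh x => by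
    rw [mul_left_comm, hC₂ h hh]
  set V := F₁.filter (fun x => c * x ∈ C₂) with hV
  set V' := F₁.filter (fun x => ¬ c * x ∈ C₂) with hV'
  set R := F₂.filter (fun x => ¬ c * x ∈ C₁) with hR
  set R' := F₂.filter (fun x => c * x ∈ C₁) with hR'
  have hVV' : #V + #V' = #F₁ := card_filter_add_card_filter_not _
  have hRR' : #R' + #R = #F₂ := card_filter_add_card_filter_not _
  have dV : #(F₁ ∩ F₂) ∣ #V' := by
    refine card_dvd_card_of_mul_mem (H₁ ⊓ H₂) _ _ hF fun h hh x hx => ?_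
    rw [hV', mem_filter, hF₁] at hx ⊢
    exact ⟨H₁.mul_mem hh.1 hx.1, by rw [hC₂' h hh.2]; exact hx.2⟩
  have dR : #(F₁ ∩ F₂) ∣ #R' := by
    refine card_dvd_card_of_mul_mem (H₁ ⊓ H₂) _ _ hF fun h hh x hx => ?_
    rw [hR', mem_filter, hF₂] at hx ⊢
    exact ⟨H₂.mul_mem hh.2 hx.1, by rw [hC₁' h hh.1]; exact hx.2⟩
  have lV : #(F₁ ∩ F₂) ≤ #V := by
    refine card_le_card fun x hx => ?_
    rw [hV, mem_filter]
    refine ⟨(mem_inter.1 hx).1, ?_⟩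
    rw [mul_comm, hC₂ x ((hF x).1 hx).2]
    exact hc.1
  have lR : #(F₁ ∩ F₂) ≤ #R := by
    refine card_le_card fun x hx => ?_
    rw [hR, mem_filter]
    refine ⟨(mem_inter.1 hx).2, ?_⟩
    rw [mul_comm, hC₁ x ((hF x).1 hx).1]
    exact hc.2
  have hpos : 0 < #(F₁ ∩ F₂) := card_pos.2 ⟨1, (hF 1).2 (one_mem _)⟩
  have kVR : #V * #R ≤ #(F₁ ∩ F₂) * #(C₂ \ C₁) := by
    refine (card_mul_card_le_card_inter_mul_card_mul H₁ H₂ F₁ F₂ V R hF₁ hF₂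
      (filter_subset _ _) (filter_subset _ _)).trans (Nat.mul_le_mul_left _ ?_)
    rw [← card_smul_finset c]
    refine card_le_card fun z hz => ?_
    obtain ⟨w, hw, rfl⟩ := mem_smul_finset.1 hz
    obtain ⟨x, hx, y, hy, rfl⟩ := mem_mul.1 hw
    rw [hV, mem_filter, hF₁] at hx
    rw [hR, mem_filter, hF₂] at hy
    rw [smul_eq_mul, mem_sdiff, hC₁' x hx.1, mul_comm x y, hC₂' y hy.1]
    exact ⟨hx.2, hy.2⟩
  have kVR' : #V' * #R' ≤ #(F₁ ∩ F₂) * #(C₁ \ C₂) := by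
    refine (card_mul_card_le_card_inter_mul_card_mul H₁ H₂ F₁ F₂ V' R' hF₁ hF₂
      (filter_subset _ _) (filter_subset _ _)).trans (Nat.mul_le_mul_left _ ?_)
    rw [← card_smul_finset c]
    refine card_le_card fun z hz => ?_
    obtain ⟨w, hw, rfl⟩ := mem_smul_finset.1 hz
    obtain ⟨x, hx, y, hy, rfl⟩ := mem_mul.1 hw
    rw [hV', mem_filter, hF₁] at hx
    rw [hR', mem_filter, hF₂] at hy
    rw [smul_eq_mul, mem_sdiff, hC₁' x hx.1, mul_comm x y, hC₂' y hy.1]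
    exact ⟨hy.2, hx.2⟩
  clear_value V V' R R'
  generalize #(F₁ ∩ F₂) = l at *
  generalize #(C₂ \ C₁) = s at *
  generalize #(C₁ \ C₂) = t at *
  rcases Nat.eq_zero_or_pos #V' with hV0 | hV0
  · have : l * #V ≤ l * s := (by nlinarith : l * #V ≤ #V * #R).trans kVR
    have := Nat.le_of_mul_le_mul_left this hpos
    omega
  rcases Nat.eq_zero_or_pos #R' with hR0 | hR0
  · have : l * #R ≤ l * s := (by nlinarith : l * #R ≤ #V * #R).trans kVR
    have := Nat.le_of_mul_le_mul_left this hpos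
    omega
  exfalso
  obtain ⟨v, hv⟩ := Nat.exists_eq_add_of_le lV
  obtain ⟨r, hr⟩ := Nat.exists_eq_add_of_le lR
  obtain ⟨v', hv'⟩ := Nat.exists_eq_add_of_le (Nat.le_of_dvd hV0 dV)
  obtain ⟨r', hr'⟩ := Nat.exists_eq_add_of_le (Nat.le_of_dvd hR0 dR)
  rw [hv, hr] at kVR
  rw [hv', hr'] at kVR'
  have e₁ : l + v + r ≤ s := Nat.le_of_mul_le_mul_left (by nlinarith) hpos
  have e₂ : l + v' + r' ≤ t := Nat.le_of_mul_le_mul_left (by nlinarith) hpos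
  omega

lemma exists_finset_mem_iff_mem_stabilizer (C : Finset G) (hC : C.Nonempty) :
    ∃ F : Finset G, (∀ x, x ∈ F ↔ x ∈ MulAction.stabilizer G C) ∧
      #F = Nat.card (MulAction.stabilizer G C) := by
  have hfin : (MulAction.stabilizer G C : Set G).Finite := by
    rw [← MulAction.stabilizer_coe_finset]
    exact MulAction.stabilizer_finite (coe_nonempty.2 hC) C.finite_toSet
  refine ⟨hfin.toFinset, fun x => by simp only [Set.Finite.mem_toFinset, SetLike.mem_coe], ?_⟩
  rw [← Set.ncard_eq_toFinset_card _ hfin]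
  rfl

/-- Kneser's lemma on unions of periodic sets. -/
lemma le_card_union_add_card_stabilizer (n : ℕ) (C₁ C₂ : Finset G) (hne₁ : C₁.Nonempty)
    (hne₂ : C₂.Nonempty)
    (h₁ : n ≤ #C₁ + Nat.card (MulAction.stabilizer G C₁))
    (h₂ : n ≤ #C₂ + Nat.card (MulAction.stabilizer G C₂)) :
    n ≤ #(C₁ ∪ C₂) + Nat.card (MulAction.stabilizer G (C₁ ∪ C₂)) := by
  by_cases h₁₂ : C₂ ⊆ C₁
  · rwa [union_eq_left.2 h₁₂]
  by_cases h₂₁ : C₁ ⊆ C₂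
  · rwa [union_eq_right.2 h₂₁]
  obtain ⟨F₁, hF₁, e₁⟩ := exists_finset_mem_iff_mem_stabilizer C₁ hne₁
  obtain ⟨F₂, hF₂, e₂⟩ := exists_finset_mem_iff_mem_stabilizer C₂ hne₂
  obtain ⟨F, hF, e⟩ := exists_finset_mem_iff_mem_stabilizer (C₁ ∪ C₂) (hne₁.mono subset_union_left)
  have hC₁ : ∀ h ∈ MulAction.stabilizer G C₁, ∀ x, h * x ∈ C₁ ↔ x ∈ C₁ := fun h hh =>
    MulAction.mem_stabilizer_finset.1 hh
  have hC₂ : ∀ h ∈ MulAction.stabilizer G C₂, ∀ x, h * x ∈ C₂ ↔ x ∈ C₂ := fun h hh =>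
    MulAction.mem_stabilizer_finset.1 hh
  have hle : #(F₁ ∩ F₂) ≤ #F := by
    refine card_le_card fun x hx => ?_
    rw [mem_inter, hF₁, hF₂, MulAction.mem_stabilizer_iff, MulAction.mem_stabilizer_iff] at hx
    rw [hF, MulAction.mem_stabilizer_iff, smul_finset_union, hx.1, hx.2]
  have u₁ : #(C₂ \ C₁) + #C₁ = #(C₁ ∪ C₂) := by rw [card_sdiff_add_card, union_comm]
  have u₂ : #(C₁ \ C₂) + #C₂ = #(C₁ ∪ C₂) := card_sdiff_add_card _ _
  by_contra! hlt
  have l₁ := card_le_card_sdiff_of_card_sdiff_lt _ _ F₁ F₂ C₁ C₂ hF₁ hF₂ hC₁ hC₂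
    (sdiff_nonempty.2 h₁₂) (by omega) (by omega)
  have l₂ := card_le_card_sdiff_of_card_sdiff_lt _ _ F₂ F₁ C₂ C₁ hF₂ hF₁ hC₂ hC₁
    (sdiff_nonempty.2 h₂₁) (by rw [inter_comm]; omega) (by rw [inter_comm]; omega)
  omega

/-- Each product `a * b` lies in a subset `C` of `A * B` satisfying the bound of Kneser's
theorem. -/
lemma exists_mem_subset_mul_card_add_card_le (A B : Finset G) (a b : G) (ha : a ∈ A)
    (hb : b ∈ B) : ∃ C ⊆ A * B, a * b ∈ C ∧
      #A + #B ≤ #C + Nat.card (MulAction.stabilizer G C) := by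
  induction hn : #B using Nat.strong_induction_on generalizing A B a b with
  | _ n ih =>
  by_cases hall : ∀ x ∈ A, ∀ y ∈ B, x * b⁻¹ * y ∈ A
  · have hsub : b • A ⊆ A * B := fun z hz => by
      obtain ⟨x, hx, rfl⟩ := mem_smul_finset.1 hz
      rw [smul_eq_mul, mul_comm b x]
      exact mul_mem_mul hx hb
    have hmem : a * b ∈ b • A := by
      rw [mul_comm]
      exact smul_mem_smul_finset ha
    refine ⟨b • A, hsub, hmem, ?_⟩
    obtain ⟨F, hF, e⟩ := exists_finset_mem_iff_mem_stabilizer (b • A) ⟨_, hmem⟩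
    rw [card_smul_finset, ← e, ← hn, add_le_add_iff_left, ← card_smul_finset b⁻¹]
    refine card_le_card fun z hz => ?_
    obtain ⟨y, hy, rfl⟩ := mem_smul_finset.1 hz
    rw [hF, MulAction.mem_stabilizer_finset']
    intro w hw
    obtain ⟨x, hx, rfl⟩ := mem_smul_finset.1 hw
    have := smul_mem_smul_finset (a := b) (hall x hx y hy)
    simp only [smul_eq_mul] at this ⊢
    convert this using 1
    rw [mul_left_comm, mul_comm x, mul_right_comm]
  · push Not at hall
    obtain ⟨x, hx, y, hy, hxy⟩ := hall
    set D := mulDysonETransform (x * b⁻¹) (A, B)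
    have hsub : D.1 * D.2 ⊆ A * B := mulDysonETransform.subset _ (A, B)
    have hcard : #D.1 + #D.2 = #A + #B := mulDysonETransform.card _ (A, B)
    have ha' : a ∈ D.1 := mem_union_left _ ha
    have hb' : b ∈ D.2 := by
      refine mem_inter.2 ⟨hb, ?_⟩
      rw [mem_inv_smul_finset_iff]
      simpa using hx
    have hlt : #D.2 < #B := by
      refine card_lt_card ⟨inter_subset_left, fun h => hxy ?_⟩
      have := (mem_inter.1 (h hy)).2
      rwa [mem_inv_smul_finset_iff, smul_eq_mul] at this
    obtain ⟨C, hC, hm, hc⟩ := ih _ (hn ▸ hlt) D.1 D.2 a b ha' hb' rfl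
    exact ⟨C, hC.trans hsub, hm, by omega⟩

lemma card_add_card_le_card_mul_add_card_stabilizer (A B : Finset G) (hA : A.Nonempty)
    (hB : B.Nonempty) :
    #A + #B ≤ #(A * B) + Nat.card (MulAction.stabilizer G (A * B)) := by
  have key : ∀ T : Finset G, T.Nonempty → T ⊆ A * B → ∃ C, T ⊆ C ∧ C ⊆ A * B ∧
      #A + #B ≤ #C + Nat.card (MulAction.stabilizer G C) := by
    intro T hT
    induction hT using Finset.Nonempty.cons_induction with
    | singleton z =>
      intro h
      obtain ⟨a, ha, b, hb, rfl⟩ := mem_mul.1 (singleton_subset_iff.1 h)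
      obtain ⟨C, hC, hm, hc⟩ := exists_mem_subset_mul_card_add_card_le A B a b ha hb
      exact ⟨C, singleton_subset_iff.2 hm, hC, hc⟩
    | cons z T hz hT ih =>
      intro h
      rw [cons_eq_insert, insert_subset_iff] at h
      obtain ⟨a, ha, b, hb, rfl⟩ := mem_mul.1 h.1
      obtain ⟨C₁, hC₁, hm, hc₁⟩ := exists_mem_subset_mul_card_add_card_le A B a b ha hb
      obtain ⟨C₂, hT₂, hC₂, hc₂⟩ := ih h.2
      refine ⟨C₁ ∪ C₂, ?_, union_subset hC₁ hC₂, le_card_union_add_card_stabilizer _ C₁ C₂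
        ⟨_, hm⟩ (hT.mono hT₂) hc₁ hc₂⟩
      rw [cons_eq_insert, insert_subset_iff]
      exact ⟨mem_union_left _ hm, hT₂.trans subset_union_right⟩
  obtain ⟨C, h₁, h₂, h⟩ := key _ (hA.mul hB) Subset.rfl
  rwa [h₂.antisymm h₁] at h

theorem stmt15 (A B : Finset G) (hA : A.Nonempty) (hB : B.Nonempty)
    (h : (A * B).card + 2 ≤ A.card + B.card) :
    2 ≤ Nat.card (MulAction.stabilizer G (A * B)) ∧
    (A * B).card + Nat.card (MulAction.stabilizer G (A * B)) =
      Nat.card ((A : Set G) * ((MulAction.stabilizer G (A * B) : Subgroup G) : Set G)) +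
      Nat.card ((B : Set G) * ((MulAction.stabilizer G (A * B) : Subgroup G) : Set G)) := by
  obtain ⟨F, hF, e⟩ := exists_finset_mem_iff_mem_stabilizer (A * B) (hA.mul hB)
  have hFc : ((MulAction.stabilizer G (A * B) : Subgroup G) : Set G) = F := by
    ext x
    rw [mem_coe, hF, SetLike.mem_coe]
  have one_mem_F : (1 : G) ∈ F := (hF 1).2 (one_mem _)
  have hABF : A * F * (B * F) = A * B := by
    rw [mul_mul_mul_comm]
    refine Subset.antisymm (fun z hz => ?_) fun z hz => ?_
    · obtain ⟨w, hw, v, hv, rfl⟩ := mem_mul.1 hz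
      obtain ⟨f, hf, g, hg, rfl⟩ := mem_mul.1 hv
      rw [mul_comm w]
      exact (MulAction.mem_stabilizer_finset.1 (mul_mem ((hF f).1 hf) ((hF g).1 hg)) w).2 hw
    · simpa using mul_mem_mul hz (mul_mem_mul one_mem_F one_mem_F)
  have kn := card_add_card_le_card_mul_add_card_stabilizer (A * F) (B * F)
    (hA.mul ⟨1, one_mem_F⟩) (hB.mul ⟨1, one_mem_F⟩)
  rw [hABF, ← e] at kn
  have dvd_mul_F (X : Finset G) : #F ∣ #(X * F) := by
    refine card_dvd_card_of_mul_mem _ F _ hF fun h hh z hz => ?_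
    obtain ⟨x, hx, f, hf, rfl⟩ := mem_mul.1 hz
    rw [mul_left_comm]
    exact mul_mem_mul hx ((hF _).2 (mul_mem hh ((hF f).1 hf)))
  have dAB : #F ∣ #(A * B) := card_dvd_card_of_mul_mem _ F _ hF fun h hh z hz =>
    (MulAction.mem_stabilizer_finset.1 hh z).2 hz
  have lA : #A ≤ #(A * F) := card_le_card_mul_right ⟨1, one_mem_F⟩
  have lB : #B ≤ #(B * F) := card_le_card_mul_right ⟨1, one_mem_F⟩
  have hlt : #(A * B) + #F ≤ #(A * F) + #(B * F) := by
    obtain ⟨k, hk⟩ := dAB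
    obtain ⟨m, hm⟩ := dvd_add (dvd_mul_F A) (dvd_mul_F B)
    have hkm : #F * k < #F * m := by omega
    have := Nat.mul_le_mul_left #F (Nat.succ_le_of_lt (lt_of_mul_lt_mul_left hkm (Nat.zero_le _)))
    rw [hk, hm]
    rwa [Nat.mul_succ] at this
  rw [hFc, ← coe_mul, ← coe_mul, Nat.card_coe_set_eq, Nat.card_coe_set_eq, Set.ncard_coe_finset,
    Set.ncard_coe_finset, ← e]
  omega
end
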